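/- arXiv:1009.2932 — 4 statements merged into one kernel-verified Lean document; each statement's English description precedes it below -/
import Mathlib

section
/- Let 𝔽 be a field, d ≥ 1, and A a d×d matrix over 𝔽. The linear map sending a thread v of A to its initial vector v 0 ∈ 𝔽^d is injective, and its image is exactly the eventual range ⋂ₙ range(Aⁿ) of A. In particular, the 𝔽-vector space of threads of A is linearly isomorphic to the eventual range of A. -/
/-- The space of threads of a matrix `A`: sequences `v` of vectors with
`v n = A · v (n+1)` for all `n`, as a submodule of `ℕ → (Fin d → 𝔽)`. -/
def threadSpace (𝔽 : Type*) [Field 𝔽] {d : ℕ} (A : Matrix (Fin d) (Fin d) 𝔽) :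
    Submodule 𝔽 (ℕ → Fin d → 𝔽) where
  carrier := {v | ∀ n, v n = A.mulVec (v (n + 1))}
  add_mem' := by
    intro u w hu hw n
    simp only [Set.mem_setOf_eq] at hu hw
    simp [Pi.add_apply, hu n, hw n, Matrix.mulVec_add]
  zero_mem' := by
    intro n
    simp [Matrix.mulVec_zero]
  smul_mem' := by
    intro c w hw n
    simp only [Set.mem_setOf_eq] at hw
    simp [Pi.smul_apply, hw n, Matrix.mulVec_smul]

/-- The eventual range `⋂ₙ range(Aⁿ)` of a matrix `A`, as a submodule of `Fin d → 𝔽`. -/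
def eventualRange (𝔽 : Type*) [Field 𝔽] {d : ℕ} (A : Matrix (Fin d) (Fin d) 𝔽) :
    Submodule 𝔽 (Fin d → 𝔽) :=
  ⨅ n : ℕ, LinearMap.range (A ^ n).mulVecLin

theorem LinearMap.injOn_iInf_range_pow {R M : Type*} [Ring R] [AddCommGroup M] [Module R M]
    [IsArtinian R M] [IsNoetherian R M] (f : Module.End R M) :
    Set.InjOn f (⨅ n : ℕ, LinearMap.range (f ^ n) : Submodule R M) := by
  rw [← LinearMap.disjoint_ker_iff_injOn]
  refine (f.isCompl_iSup_ker_pow_iInf_range_pow.disjoint.mono_left ?_).symm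
  simpa using le_iSup (fun n : ℕ => LinearMap.ker (f ^ n)) 1

theorem LinearMap.exists_mem_iInf_range_pow_apply_eq {R M : Type*} [Ring R] [AddCommGroup M]
    [Module R M] [IsArtinian R M] (f : Module.End R M) {x : M}
    (hx : x ∈ ⨅ n : ℕ, LinearMap.range (f ^ n)) :
    ∃ y ∈ ⨅ n : ℕ, LinearMap.range (f ^ n), f y = x := by
  obtain ⟨k, hk⟩ := Filter.eventually_atTop.mp f.eventually_iInf_range_pow_eq
  obtain ⟨z, rfl⟩ := (Submodule.mem_iInf _).mp hx (k + 1)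
  refine ⟨(f ^ k) z, ?_, by rw [pow_succ', Module.End.mul_apply]⟩
  rw [hk k le_rfl]
  exact LinearMap.mem_range_self _ z

section Thread

variable {𝔽 : Type*} [Field 𝔽] {d : ℕ} {A : Matrix (Fin d) (Fin d) 𝔽}

theorem eventualRange_eq_iInf_range_mulVecLin_pow :
    eventualRange 𝔽 A = ⨅ n : ℕ, LinearMap.range (A.mulVecLin ^ n) := by
  simp only [eventualRange, ← Matrix.toLin'_apply', Matrix.toLin'_pow]

theorem threadSpace_eq_pow_mulVec {v : ℕ → Fin d → 𝔽} (hv : v ∈ threadSpace 𝔽 A) (n k : ℕ) :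
    v n = (A ^ k).mulVec (v (n + k)) := by
  induction k with
  | zero => simp
  | succ k ih => rw [ih, hv (n + k), Matrix.mulVec_mulVec, ← pow_succ, add_assoc]

theorem threadSpace_apply_mem_eventualRange {v : ℕ → Fin d → 𝔽} (hv : v ∈ threadSpace 𝔽 A)
    (n : ℕ) : v n ∈ eventualRange 𝔽 A :=
  (Submodule.mem_iInf _).mpr fun k => ⟨v (n + k), (threadSpace_eq_pow_mulVec hv n k).symm⟩

/-- The linear map sending a thread to its initial vector. -/
def threadSpaceInitial (A : Matrix (Fin d) (Fin d) 𝔽) : threadSpace 𝔽 A →ₗ[𝔽] Fin d → 𝔽 :=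
  LinearMap.proj 0 ∘ₗ (threadSpace 𝔽 A).subtype

theorem threadSpaceInitial_injective : Function.Injective (threadSpaceInitial A) := by
  rintro ⟨v, hv⟩ ⟨w, hw⟩ h
  have hinj := LinearMap.injOn_iInf_range_pow A.mulVecLin
  rw [← eventualRange_eq_iInf_range_mulVecLin_pow] at hinj
  refine Subtype.ext (funext fun n => ?_)
  induction n with
  | zero => exact h
  | succ n ih =>
    refine hinj (threadSpace_apply_mem_eventualRange hv _)
      (threadSpace_apply_mem_eventualRange hw _) ?_
    exact (hv n).symm.trans (ih.trans (hw n))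

theorem range_threadSpaceInitial :
    LinearMap.range (threadSpaceInitial A) = eventualRange 𝔽 A := by
  refine le_antisymm ?_ fun x hx => ?_
  · rintro _ ⟨v, rfl⟩
    exact threadSpace_apply_mem_eventualRange v.2 0
  · have hsurj : ∀ y : eventualRange 𝔽 A, ∃ z : eventualRange 𝔽 A, A.mulVec z = y := by
      rintro ⟨y, hy⟩
      rw [eventualRange_eq_iInf_range_mulVecLin_pow] at hy
      obtain ⟨z, hz, h⟩ := LinearMap.exists_mem_iInf_range_pow_apply_eq A.mulVecLin hy
      rw [← eventualRange_eq_iInf_range_mulVecLin_pow] at hz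
      exact ⟨⟨z, hz⟩, h⟩
    choose g hg using hsurj
    refine ⟨⟨fun n => g^[n] ⟨x, hx⟩, fun n => ?_⟩, rfl⟩
    simp only [Function.iterate_succ_apply', hg]

end Thread

/-- the map sending a thread to its initial vector is injective with
image the eventual range of `A`; in particular the thread space is linearly
isomorphic to the eventual range. -/
theorem stmt_5 (𝔽 : Type*) [Field 𝔽] (d : ℕ) (hd : 1 ≤ d)
    (A : Matrix (Fin d) (Fin d) 𝔽) :
    Function.Injective (fun v : threadSpace 𝔽 A => (v : ℕ → Fin d → 𝔽) 0) ∧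
    Set.range (fun v : threadSpace 𝔽 A => (v : ℕ → Fin d → 𝔽) 0) =
      (eventualRange 𝔽 A : Set (Fin d → 𝔽)) ∧
    Nonempty (threadSpace 𝔽 A ≃ₗ[𝔽] eventualRange 𝔽 A) := by
  exact ⟨threadSpaceInitial_injective,
    congrArg (fun S : Submodule 𝔽 (Fin d → 𝔽) => (S : Set (Fin d → 𝔽))) range_threadSpaceInitial,
    ⟨(LinearEquiv.ofInjective _ threadSpaceInitial_injective).trans
      (LinearEquiv.ofEq _ _ range_threadSpaceInitial)⟩⟩
end

section
/- Let A be a primitive d×d {0,1}-matrix, λ > 0 a real number, and r ∈ ℝ^d a vector with all entries strictly positive such that A·r = λ·r. Then there exists a finite Borel measure ν on the compact space Λ⁺_A such that for every n ≥ 1 and every allowable block b = (b₀,…,b_{n−1}) of length n, ν([b]) = λ^{−(n−1)} · r_{b_{n−1}}, where [b] is the cylinder set of b. -/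
open MeasureTheory

section MarkovChain

open ProbabilityTheory Preorder

variable {α : Type*} [MeasurableSpace α]

/-- The transition kernel `P` read as a kernel on histories that only looks at the last state. -/
noncomputable def lastStateKernel (P : Kernel α α) (n : ℕ) :
    Kernel ((i : Finset.Iic n) → (fun _ : ℕ => α) i) ((fun _ : ℕ => α) (n + 1)) :=
  P.comap (fun x => x ⟨n, Finset.mem_Iic.2 le_rfl⟩) (by fun_prop)

instance (P : Kernel α α) [IsMarkovKernel P] (n : ℕ) : IsMarkovKernel (lastStateKernel P n) := by
  unfold lastStateKernel; infer_instance

/-- The law of the Markov chain with initial distribution `μ` and transition kernel `P`. -/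
noncomputable def markovMeasure (μ : Measure α) (P : Kernel α α) [IsMarkovKernel P] :
    Measure (ℕ → α) :=
  Kernel.trajMeasure (X := fun _ => α) μ (lastStateKernel P)

variable (μ : Measure α) (P : Kernel α α) [IsMarkovKernel P]

instance [IsProbabilityMeasure μ] : IsProbabilityMeasure (markovMeasure μ P) := by
  unfold markovMeasure; infer_instance

theorem markovMeasure_map_zero : (markovMeasure μ P).map (fun x => x 0) = μ := by
  have hf : (fun x : ℕ → α => x 0) =
      (MeasurableEquiv.piUnique (fun _ : Finset.Iic 0 => α)) ∘ frestrictLe (π := fun _ => α) 0 := rfl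
  rw [hf, ← Measure.map_map (by fun_prop) (by fun_prop), markovMeasure, Kernel.trajMeasure,
    Measure.map_comp _ _ (by fun_prop), Kernel.traj_map_frestrictLe, Kernel.partialTraj_self,
    Measure.id_comp, Measure.map_map (by fun_prop) (by fun_prop)]
  exact Measure.map_id

variable [IsProbabilityMeasure μ]

theorem markovMeasure_map_frestrictLe_compProd (n : ℕ) :
    (markovMeasure μ P).map (frestrictLe (π := fun _ => α) n) ⊗ₘ lastStateKernel P n =
      (markovMeasure μ P).map (fun x => (frestrictLe (π := fun _ => α) n x, x (n + 1))) :=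
  Kernel.map_frestrictLe_trajMeasure_compProd_eq_map_trajMeasure

theorem ae_markovMeasure_step [Countable α] [MeasurableSingletonClass α] {R : α → α → Prop}
    (hR : ∀ i, ∀ᵐ j ∂P i, R i j) : ∀ᵐ x ∂markovMeasure μ P, ∀ n, R (x n) (x (n + 1)) := by
  rw [ae_all_iff]
  intro n
  have h : ∀ᵐ y ∂((markovMeasure μ P).map (frestrictLe (π := fun _ => α) n) ⊗ₘ
      lastStateKernel P n), R (y.1 ⟨n, Finset.mem_Iic.2 le_rfl⟩) y.2 := by
    rw [Measure.ae_compProd_iff (Set.to_countable _).measurableSet]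
    exact Filter.Eventually.of_forall fun x => hR _
  rw [markovMeasure_map_frestrictLe_compProd] at h
  exact ae_of_ae_map (by fun_prop) h

theorem markovMeasure_cylinder [Countable α] [MeasurableSingletonClass α] (w : ℕ → α) (n : ℕ) :
    markovMeasure μ P {x | ∀ i ≤ n, x i = w i} =
      μ {w 0} * ∏ i ∈ Finset.range n, P (w i) {w (i + 1)} := by
  induction n with
  | zero =>
    conv_rhs => rw [← markovMeasure_map_zero μ P]
    rw [Measure.map_apply (by fun_prop) (measurableSet_singleton _)]
    simp [Set.preimage]
  | succ n ih =>
    rw [Finset.prod_range_succ, ← mul_assoc, ← ih]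
    have hpre : {x : ℕ → α | ∀ i ≤ n, x i = w i} =
        frestrictLe (π := fun _ => α) n ⁻¹' {frestrictLe (π := fun _ => α) n w} := by
      ext x
      simp [funext_iff]
    have hpre' : {x : ℕ → α | ∀ i ≤ n + 1, x i = w i} =
        (fun x => (frestrictLe (π := fun _ => α) n x, x (n + 1))) ⁻¹'
          ({frestrictLe (π := fun _ => α) n w} ×ˢ {w (n + 1)}) := by
      ext x
      simp [funext_iff, Nat.le_succ_iff, or_imp, forall_and]
    rw [hpre', hpre, ← Measure.map_apply (by fun_prop) (by measurability),
      ← Measure.map_apply (by fun_prop) (measurableSet_singleton _),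
      ← markovMeasure_map_frestrictLe_compProd,
      Measure.compProd_apply_prod (measurableSet_singleton _) (measurableSet_singleton _),
      lintegral_singleton, mul_comm]
    rfl

end MarkovChain

theorem prod_range_div_mul_telescope {lam : ℝ} (u : ℕ → ℝ) (hu : ∀ i, 0 < u i) (n : ℕ) :
    u 0 * ∏ i ∈ Finset.range n, (u (i + 1) / (lam * u i)) = (lam ^ n)⁻¹ * u n := by
  induction n with
  | zero => simp
  | succ n ih =>
    rw [Finset.prod_range_succ, ← mul_assoc, ih, pow_succ]
    have := (hu n).ne'
    field_simp

/-- for a primitive `{0,1}`-matrix `A` with positive right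
eigenvector `r` for the eigenvalue `lam > 0`, there is a finite Borel measure `ν` on
the one-sided subshift `Λ⁺_A` assigning to the cylinder of every allowable block `b`
of length `n` the value `lam^{−(n−1)} · r_{b_{n−1}}`. -/
theorem stmt_10 (d : ℕ) (A : Matrix (Fin d) (Fin d) ℝ)
    (h01 : ∀ i j, A i j = 0 ∨ A i j = 1)
    (hprim : ∃ m : ℕ, 1 ≤ m ∧ ∀ i j, 0 < (A ^ m) i j)
    (lam : ℝ) (hlam : 0 < lam)
    (r : Fin d → ℝ) (hr : ∀ j, 0 < r j)
    (heig : A.mulVec r = lam • r) :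
    ∃ ν : Measure {s : ℕ → Fin d // ∀ k, A (s k) (s (k + 1)) = 1},
      IsFiniteMeasure ν ∧
      ∀ (b : List (Fin d)) (hb : b ≠ []),
        List.Chain' (fun i j => A i j = 1) b →
        ν {s | ∀ i : Fin b.length, (s : ℕ → Fin d) (i : ℕ) = b.get i} =
          ENNReal.ofReal ((lam ^ (b.length - 1))⁻¹ * r (b.getLast hb)) := by
  classical
  rcases isEmpty_or_nonempty (Fin d) with hd | hd
  · exact ⟨0, inferInstance, fun b hb => isEmptyElim (b.head hb)⟩
  have hR : 0 < ∑ j, r j := Finset.sum_pos (fun j _ => hr j) Finset.univ_nonempty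
  have hA : ∀ i j, 0 ≤ A i j := fun i j => by rcases h01 i j with h | h <;> simp [h]
  have hq : ∀ i j, 0 ≤ A i j * r j / (lam * r i) := fun i j =>
    div_nonneg (mul_nonneg (hA i j) (hr j).le) (mul_pos hlam (hr i)).le
  let p₀ : PMF (Fin d) := PMF.ofFintype (fun j => ENNReal.ofReal (r j / ∑ j, r j)) (by
    rw [← ENNReal.ofReal_sum_of_nonneg fun j _ => (div_pos (hr j) hR).le, ← Finset.sum_div,
      div_self hR.ne', ENNReal.ofReal_one])
  let p : Fin d → PMF (Fin d) := fun i =>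
    PMF.ofFintype (fun j => ENNReal.ofReal (A i j * r j / (lam * r i))) (by
      have h : ∑ j, A i j * r j = lam * r i := congrFun heig i
      rw [← ENNReal.ofReal_sum_of_nonneg fun j _ => hq i j, ← Finset.sum_div, h,
        div_self (mul_pos hlam (hr i)).ne', ENNReal.ofReal_one])
  let P : ProbabilityTheory.Kernel (Fin d) (Fin d) :=
    ProbabilityTheory.Kernel.ofFunOfCountable fun i => (p i).toMeasure
  have hP : ∀ i j, P i {j} = ENNReal.ofReal (A i j * r j / (lam * r i)) := fun i j =>
    (p i).toMeasure_apply_singleton j (measurableSet_singleton j)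
  have : ProbabilityTheory.IsMarkovKernel P :=
    ⟨fun i => inferInstanceAs (IsProbabilityMeasure (p i).toMeasure)⟩
  let M : Measure (ℕ → Fin d) := markovMeasure p₀.toMeasure P
  have : IsProbabilityMeasure M := inferInstanceAs (IsProbabilityMeasure (markovMeasure _ _))
  have hsupp : ∀ᵐ x ∂M, ∀ k, A (x k) (x (k + 1)) = 1 := by
    refine ae_markovMeasure_step _ _ (R := fun i j => A i j = 1) fun i => ?_
    rw [ae_iff_of_countable]
    intro j hj
    rw [hP] at hj
    exact (h01 i j).resolve_left fun h => hj (by simp [h])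
  have hmeas : MeasurableSet {s : ℕ → Fin d | ∀ k, A (s k) (s (k + 1)) = 1} := by
    rw [Set.ofPred_forall]
    refine MeasurableSet.iInter fun k => ?_
    exact (Set.to_countable {q : Fin d × Fin d | A q.1 q.2 = 1}).measurableSet.preimage
      (f := fun s : ℕ → Fin d => (s k, s (k + 1))) (by fun_prop)
  have hemb : MeasurableEmbedding (Subtype.val :
      {s : ℕ → Fin d // ∀ k, A (s k) (s (k + 1)) = 1} → ℕ → Fin d) :=
    MeasurableEmbedding.subtype_coe hmeas
  refine ⟨ENNReal.ofReal (∑ j, r j) • M.comap Subtype.val, ?_, fun b hb hchain => ?_⟩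
  · have : IsFiniteMeasure (M.comap (Subtype.val :
        {s : ℕ → Fin d // ∀ k, A (s k) (s (k + 1)) = 1} → ℕ → Fin d)) :=
      ⟨by rw [hemb.comap_apply]; exact measure_lt_top _ _⟩
    exact Measure.smul_finite _ ENNReal.ofReal_ne_top
  obtain ⟨n, hn⟩ : ∃ n, b.length = n + 1 :=
    Nat.exists_eq_succ_of_ne_zero (by simpa using hb)
  let w : ℕ → Fin d := fun i => b.getD i (b.head hb)
  have hw : ∀ i (hi : i < b.length), w i = b[i] := fun i hi => List.getD_eq_getElem _ _ hi
  have hlast : b.getLast hb = w n := by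
    rw [List.getLast_eq_getElem, hw n (by omega)]
    simp [hn]
  have hstep : ∀ i < n, A (w i) (w (i + 1)) = 1 := fun i hi => by
    rw [hw i (by omega), hw (i + 1) (by omega)]
    exact List.isChain_iff_getElem.1 hchain i (by omega)
  have hcyl : M.comap Subtype.val {s : {s : ℕ → Fin d // ∀ k, A (s k) (s (k + 1)) = 1} |
      ∀ i : Fin b.length, (s : ℕ → Fin d) (i : ℕ) = b.get i} =
      M {x | ∀ i ≤ n, x i = w i} := by
    rw [hemb.comap_apply]
    refine measure_congr (Filter.eventuallyEq_set.2 ?_)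
    filter_upwards [hsupp] with x hx
    refine ⟨?_, fun h => ⟨⟨x, hx⟩, fun i => ?_, rfl⟩⟩
    · rintro ⟨s, hs, rfl⟩ i hi
      rw [hw i (by omega)]
      exact hs ⟨i, by omega⟩
    · exact (h i (by have := i.2; omega)).trans (hw i i.2)
  have hprod : ∏ i ∈ Finset.range n, P (w i) {w (i + 1)} =
      ENNReal.ofReal (∏ i ∈ Finset.range n, (r (w (i + 1)) / (lam * r (w i)))) := by
    rw [ENNReal.ofReal_prod_of_nonneg fun i _ => (div_pos (hr _) (mul_pos hlam (hr _))).le]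
    refine Finset.prod_congr rfl fun i hi => ?_
    rw [hP, hstep i (Finset.mem_range.1 hi), one_mul]
  have hp₀ : p₀.toMeasure {w 0} = ENNReal.ofReal (r (w 0) / ∑ j, r j) :=
    p₀.toMeasure_apply_singleton _ (measurableSet_singleton _)
  rw [Measure.smul_apply, hcyl, smul_eq_mul, markovMeasure_cylinder, hprod, hp₀, ← mul_assoc,
    ← ENNReal.ofReal_mul hR.le, mul_div_cancel₀ _ hR.ne',
    ← ENNReal.ofReal_mul (hr _).le, prod_range_div_mul_telescope (fun i => r (w i)) fun i => hr _,
    hn, hlast, Nat.add_sub_cancel]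
end

section
/- Let f : ℝ → ℂ, let c < d be reals, and let C > 0 and 0 < ν < 1. Suppose that for every p ∈ [c,d) and every p' ∈ (p,d], sup{ |f(t) − f(p)| : p < t ≤ p' } ≥ C·(p'−p)^ν. Then f does not have bounded variation on [c,d]: the total variation of f over [c,d] is infinite. -/
open Filter Topology
open scoped ENNReal NNReal

/-- The variation over `[p,q]` dominates the supremum of the distances to the value at `p`. -/
theorem iSup_nnnorm_sub_le_eVariationOn {E : Type*} [SeminormedAddCommGroup E] (f : ℝ → E)
    (p q : ℝ) :
    (⨆ t ∈ Set.Ioc p q, (‖f t - f p‖₊ : ℝ≥0∞)) ≤ eVariationOn f (Set.Icc p q) := by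
  refine iSup₂_le fun t ht => ?_
  rw [← enorm_eq_nnnorm, ← edist_eq_enorm_sub]
  exact eVariationOn.edist_le f ⟨ht.1.le, ht.2⟩ ⟨le_rfl, ht.1.le.trans ht.2⟩

/-- If `f` has variation at least `a` on every interval of length `h` in `[c,d]`, then it has
variation at least `n * a` on `[c, c + n * h]`. -/
theorem natCast_mul_le_eVariationOn {E : Type*} [PseudoEMetricSpace E] (f : ℝ → E)
    {c d h : ℝ} (hh : 0 ≤ h) {a : ℝ≥0∞}
    (H : ∀ p, c ≤ p → p + h ≤ d → a ≤ eVariationOn f (Set.Icc p (p + h))) (n : ℕ)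
    (hn : c + n * h ≤ d) : n * a ≤ eVariationOn f (Set.Icc c (c + n * h)) := by
  induction n with
  | zero => simp
  | succ k ih =>
    push_cast at hn ⊢
    have hk : c ≤ c + k * h := le_add_of_nonneg_right (by positivity)
    have e : c + (k + 1) * h = c + k * h + h := by ring
    rw [e] at hn ⊢
    have hstep : c + k * h ≤ c + k * h + h := le_add_of_nonneg_right hh
    have hadd := eVariationOn.Icc_add_Icc f (s := Set.univ) hk hstep (Set.mem_univ _)
    simp only [Set.univ_inter] at hadd
    rw [← hadd, add_mul, one_mul]
    exact add_le_add (ih (hstep.trans hn)) (H _ hk hn)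

/-- a function that is `(C,ν)`-steep from the right (`0 < ν < 1`) at
every point of `[c,d)` has infinite total variation on `[c,d]`. -/
theorem stmt_17 (f : ℝ → ℂ) (c d : ℝ) (hcd : c < d) (C ν : ℝ)
    (hC : 0 < C) (hν0 : 0 < ν) (hν1 : ν < 1)
    (hsteep : ∀ p ∈ Set.Ico c d, ∀ p' ∈ Set.Ioc p d,
      ENNReal.ofReal (C * (p' - p) ^ ν) ≤
        ⨆ t ∈ Set.Ioc p p', (‖f t - f p‖₊ : ℝ≥0∞)) :
    eVariationOn f (Set.Icc c d) = ⊤ := by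
  have hL : 0 < d - c := sub_pos.2 hcd
  have key : ∀ n : ℕ, 0 < n →
      ENNReal.ofReal (C * (d - c) ^ ν * (n : ℝ) ^ (1 - ν)) ≤ eVariationOn f (Set.Icc c d) := by
    intro n hn
    have hn' : (0 : ℝ) < n := Nat.cast_pos.2 hn
    have hh : 0 < (d - c) / n := div_pos hL hn'
    have hend : c + n * ((d - c) / n) = d := by field_simp; ring
    have hbound := natCast_mul_le_eVariationOn f (d := d) hh.le
      (a := ENNReal.ofReal (C * ((d - c) / n) ^ ν)) (fun p hp hpd => by
        have := hsteep p ⟨hp, by linarith⟩ (p + (d - c) / n) ⟨by linarith, hpd⟩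
        rw [add_sub_cancel_left] at this
        exact this.trans (iSup_nnnorm_sub_le_eVariationOn f _ _)) n hend.le
    rw [hend, ← ENNReal.ofReal_natCast, ← ENNReal.ofReal_mul hn'.le] at hbound
    convert hbound using 2
    rw [Real.div_rpow hL.le hn'.le, Real.rpow_sub hn', Real.rpow_one]
    ring
  have hlim : Tendsto (fun n : ℕ => ENNReal.ofReal (C * (d - c) ^ ν * (n : ℝ) ^ (1 - ν)))
      atTop (𝓝 ⊤) :=
    ENNReal.tendsto_ofReal_atTop.comp <|
      ((tendsto_rpow_atTop (sub_pos.2 hν1)).comp tendsto_natCast_atTop_atTop).const_mul_atTop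
        (by positivity)
  exact top_unique (le_of_tendsto hlim ((eventually_gt_atTop 0).mono key))
end

section
/- Let f : ℝ → ℝ be continuous, let c < d be reals, and let C > 0 and 0 < ν < 1. Suppose that for every p ∈ [c,d) and every p' ∈ (p,d], sup{ |f(t) − f(p)| : p < t ≤ p' } ≥ C·(p'−p)^ν. Then f is not injective on [c,d]; in particular (since the hypothesis passes to subintervals), f is injective on no nondegenerate subinterval of [c,d]. -/
open Filter Topology
open scoped ENNReal NNReal

/-- No real function on a nondegenerate interval has all its increments bounded below by
`C * (y - x) ^ ν` with `C > 0` and `ν < 1`. -/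
theorem not_forall_rpow_le_sub (g : ℝ → ℝ) {a b C ν : ℝ} (hab : a < b) (hC : 0 < C)
    (hν : ν < 1) :
    ¬ ∀ x ∈ Set.Ico a b, ∀ y ∈ Set.Ioc x b, C * (y - x) ^ ν ≤ g y - g x := by
  intro h
  have hL : 0 < b - a := sub_pos.2 hab
  have bound (n : ℕ) (hn : 0 < n) :
      C * (b - a) ^ ν * (n : ℝ) ^ (1 - ν) ≤ g b - g a := by
    have hn' : (0 : ℝ) < n := Nat.cast_pos.2 hn
    have hs : 0 < (b - a) / n := div_pos hL hn'
    have hend : a + n * ((b - a) / n) = b := by field_simp; ring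
    have partition (k : ℕ) (hk : k ≤ n) :
        k * (C * ((b - a) / n) ^ ν) ≤ g (a + k * ((b - a) / n)) - g a := by
      induction k with
      | zero => simp
      | succ k ih =>
        have hk' : ((k + 1 : ℕ) : ℝ) * ((b - a) / n) ≤ n * ((b - a) / n) := by gcongr
        have hk0 : 0 ≤ (k : ℝ) * ((b - a) / n) := by positivity
        push_cast at hk' ⊢
        have step := h (a + k * ((b - a) / n)) ⟨by linarith, by linarith⟩
          (a + (k + 1) * ((b - a) / n)) ⟨by linarith, by linarith⟩
        rw [show a + (k + 1) * ((b - a) / n) - (a + k * ((b - a) / n)) = (b - a) / n by ring]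
          at step
        linarith [ih (by omega)]
    have total := partition n le_rfl
    rw [hend, Real.div_rpow hL.le hn'.le] at total
    refine le_of_eq_of_le ?_ total
    rw [Real.rpow_sub hn', Real.rpow_one]
    ring
  have lim : Tendsto (fun n : ℕ => C * (b - a) ^ ν * (n : ℝ) ^ (1 - ν)) atTop atTop :=
    ((tendsto_rpow_atTop (sub_pos.2 hν)).comp tendsto_natCast_atTop_atTop).const_mul_atTop
      (mul_pos hC (Real.rpow_pos_of_pos hL ν))
  obtain ⟨n, hn, hn0⟩ := ((lim.eventually_gt_atTop (g b - g a)).and (eventually_gt_atTop 0)).exists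
  exact (bound n hn0).not_gt hn

/-- For a monotone function, steepness from the right is a lower bound on increments. -/
theorem MonotoneOn.rpow_le_sub_of_steep {g : ℝ → ℝ} {a b C ν x y : ℝ}
    (hg : MonotoneOn g (Set.Icc a b)) (hx : x ∈ Set.Ico a b) (hy : y ∈ Set.Ioc x b)
    (h : ENNReal.ofReal (C * (y - x) ^ ν) ≤ ⨆ t ∈ Set.Ioc x y, (‖g t - g x‖₊ : ℝ≥0∞)) :
    C * (y - x) ^ ν ≤ g y - g x := by
  have hx' : x ∈ Set.Icc a b := Set.Ico_subset_Icc_self hx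
  have hy' : y ∈ Set.Icc a b := ⟨hx.1.trans hy.1.le, hy.2⟩
  refine (ENNReal.ofReal_le_ofReal_iff (sub_nonneg.2 (hg hx' hy' hy.1.le))).1
    (h.trans (iSup₂_le fun t ht => ?_))
  have ht' : t ∈ Set.Icc a b := ⟨hx.1.trans ht.1.le, ht.2.trans hy.2⟩
  rw [← enorm_eq_nnnorm, Real.enorm_of_nonneg (sub_nonneg.2 (hg hx' ht' ht.1.le))]
  exact ENNReal.ofReal_le_ofReal (sub_le_sub_right (hg ht' hy' ht.2) _)

/-- a continuous real function that is `(C,ν)`-steep from the right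
(`0 < ν < 1`) at every point of `[c,d)` is not injective on `[c,d]`; in particular,
since the hypothesis passes to subintervals, it is injective on no nondegenerate
subinterval of `[c,d]`. -/
theorem stmt_19 (f : ℝ → ℝ) (hf : Continuous f) (c d : ℝ) (hcd : c < d) (C ν : ℝ)
    (hC : 0 < C) (hν0 : 0 < ν) (hν1 : ν < 1)
    (hsteep : ∀ p ∈ Set.Ico c d, ∀ p' ∈ Set.Ioc p d,
      ENNReal.ofReal (C * (p' - p) ^ ν) ≤
        ⨆ t ∈ Set.Ioc p p', (‖f t - f p‖₊ : ℝ≥0∞)) :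
    ¬ Set.InjOn f (Set.Icc c d) ∧
    ∀ c' d' : ℝ, c ≤ c' → c' < d' → d' ≤ d → ¬ Set.InjOn f (Set.Icc c' d') := by
  suffices main : ∀ c' d' : ℝ, c ≤ c' → c' < d' → d' ≤ d → ¬ Set.InjOn f (Set.Icc c' d') from
    ⟨main c d le_rfl hcd le_rfl, main⟩
  intro c' d' hc hcd' hd hinj
  have steep (x) (hx : x ∈ Set.Ico c' d') (y) (hy : y ∈ Set.Ioc x d') :=
    hsteep x ⟨hc.trans hx.1, hx.2.trans_le hd⟩ y ⟨hy.1, hy.2.trans hd⟩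
  rcases hf.continuousOn.strictMonoOn_of_injOn_Icc' hcd'.le hinj with hmono | hanti
  · exact not_forall_rpow_le_sub f hcd' hC hν1 fun x hx y hy =>
      hmono.monotoneOn.rpow_le_sub_of_steep hx hy (steep x hx y hy)
  · refine not_forall_rpow_le_sub (-f) hcd' hC hν1 fun x hx y hy =>
      hanti.antitoneOn.neg.rpow_le_sub_of_steep hx hy ((steep x hx y hy).trans_eq ?_)
    refine iSup_congr fun t => iSup_congr fun _ => ?_
    rw [neg_sub_neg, ← nnnorm_neg, neg_sub]
end
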